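/- arXiv:1011.4671 — 2 statements merged into one kernel-verified Lean document; each statement's English description precedes it below -/
import Mathlib

section
/- For the 2-dimensional rook walk numbers, the second-order asymptotic correction holds: n · ( a(n,n) / (√(2/(πn)) · 3^{2n−1}) − 1 ) tends to −5/32 as n → ∞. -/
/-- The set of `d`-dimensional rook walks from the origin to `v`: a walk is a
finite sequence of steps, each step adding a positive integer amount to
exactly one coordinate (a step is recorded as a pair of the chosen coordinate
and the positive amount added). -/
def RookWalks (d : ℕ) (v : Fin d → ℕ) : Set (List (Fin d × ℕ)) :=
  {L | (∀ s ∈ L, 0 < s.2) ∧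
       ∀ i : Fin d, (L.map (fun s => if s.1 = i then s.2 else 0)).sum = v i}

/-- The number of `d`-dimensional rook walks from the origin to `v`. -/
noncomputable def rookWalkCount (d : ℕ) (v : Fin d → ℕ) : ℕ :=
  (RookWalks d v).ncard

open Filter Real

theorem nil_mem_rookWalks_iff {d : ℕ} {v : Fin d → ℕ} : [] ∈ RookWalks d v ↔ v = 0 := by
  simp [RookWalks, funext_iff, eq_comm]

theorem cons_mem_rookWalks_iff {d : ℕ} {v : Fin d → ℕ} {s : Fin d × ℕ}
    {L : List (Fin d × ℕ)} :
    s :: L ∈ RookWalks d v ↔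
      0 < s.2 ∧ s.2 ≤ v s.1 ∧ L ∈ RookWalks d (Function.update v s.1 (v s.1 - s.2)) := by
  simp only [RookWalks, Set.mem_ofPred_eq, List.forall_mem_cons, List.map_cons, List.sum_cons]
  constructor
  · rintro ⟨⟨hs, hL⟩, h⟩
    have hle := h s.1
    rw [if_pos rfl] at hle
    refine ⟨hs, by omega, hL, fun i => ?_⟩
    have hi := h i
    rcases eq_or_ne i s.1 with rfl | hne
    · rw [Function.update_self]; omega
    · rw [Function.update_of_ne hne]
      rw [if_neg hne.symm] at hi
      omega
  · rintro ⟨hs, hle, hL, h⟩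
    refine ⟨⟨hs, hL⟩, fun i => ?_⟩
    have hi := h i
    rcases eq_or_ne i s.1 with rfl | hne
    · rw [Function.update_self] at hi
      rw [if_pos rfl]; omega
    · rw [Function.update_of_ne hne] at hi
      rw [if_neg hne.symm]
      omega

/-- Decomposition of the nonempty walks according to the first step, which is recorded by its
coordinate `p.1` and by the value `p.2` that remains to be reached in this coordinate. -/
theorem rookWalks_eq_biUnion {d : ℕ} {v : Fin d → ℕ} (hv : v ≠ 0) :
    RookWalks d v = ⋃ p ∈ (Finset.univ.sigma fun i => Finset.range (v i)),
      List.cons (p.1, v p.1 - p.2) '' RookWalks d (Function.update v p.1 p.2) := by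
  ext L
  simp only [Set.mem_iUnion, Set.mem_image, Finset.mem_sigma, Finset.mem_univ, true_and,
    Finset.mem_range, exists_prop]
  constructor
  · intro h
    cases L with
    | nil => exact absurd (nil_mem_rookWalks_iff.1 h) hv
    | cons s L =>
      obtain ⟨hs, hle, hL⟩ := cons_mem_rookWalks_iff.1 h
      refine ⟨⟨s.1, v s.1 - s.2⟩, by dsimp only; omega, L, hL, ?_⟩
      rw [show v s.1 - (v s.1 - s.2) = s.2 by omega]
  · rintro ⟨⟨i, k⟩, hk, L, hL, rfl⟩
    dsimp only at hk hL ⊢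
    refine cons_mem_rookWalks_iff.2 ⟨by dsimp only; omega, by dsimp only; omega, ?_⟩
    dsimp only
    rwa [show v i - (v i - k) = k by omega]

theorem rookWalks_zero (d : ℕ) : RookWalks d 0 = {[]} := by
  ext L
  cases L with
  | nil => simp [nil_mem_rookWalks_iff]
  | cons s L =>
    simp only [cons_mem_rookWalks_iff, Pi.zero_apply, Set.mem_singleton_iff, reduceCtorEq,
      iff_false]
    omega

theorem finite_rookWalks (d : ℕ) (v : Fin d → ℕ) : (RookWalks d v).Finite := by
  induction h : ∑ i, v i using Nat.strong_induction_on generalizing v with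
  | _ N ih =>
    by_cases hv : v = 0
    · rw [hv, rookWalks_zero]
      exact Set.finite_singleton _
    · rw [rookWalks_eq_biUnion hv]
      refine Set.Finite.biUnion (Finset.finite_toSet _) fun p hp => Set.Finite.image _ ?_
      have hp' : p.2 < v p.1 := by simpa using hp
      refine ih _ ?_ _ rfl
      rw [← h]
      refine Finset.sum_lt_sum (fun i _ => ?_) ⟨p.1, Finset.mem_univ _, by simpa using hp'⟩
      rcases eq_or_ne i p.1 with rfl | hne
      · simpa using hp'.le
      · simp [Function.update_of_ne hne]

theorem rookWalkCount_zero (d : ℕ) : rookWalkCount d 0 = 1 := by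
  rw [rookWalkCount, rookWalks_zero, Set.ncard_singleton]

theorem rookWalkCount_eq_sum {d : ℕ} {v : Fin d → ℕ} (hv : v ≠ 0) :
    rookWalkCount d v =
      ∑ i, ∑ k ∈ Finset.range (v i), rookWalkCount d (Function.update v i k) := by
  rw [rookWalkCount, rookWalks_eq_biUnion hv, Finset.sum_sigma']
  refine (Set.Finite.ncard_biUnion (Finset.finite_toSet _)
    (fun p _ => (finite_rookWalks d _).image _) ?_).trans ?_
  · rintro ⟨i, k⟩ hk ⟨j, l⟩ hl hne
    rw [Function.onFun, Set.disjoint_left]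
    rintro _ ⟨L, -, rfl⟩ ⟨L', -, h⟩
    apply hne
    simp only [Finset.coe_sigma, Set.mem_sigma_iff, Finset.mem_coe, Finset.mem_range] at hk hl
    simp only [List.cons.injEq, Prod.mk.injEq] at h
    obtain ⟨⟨rfl, h⟩, -⟩ := h
    rw [show k = l by omega]
  · rw [finsum_mem_coe_finset]
    exact Finset.sum_congr rfl fun p _ =>
      Set.ncard_image_of_injective _ List.cons_injective

theorem rookWalkCount_two_eq_sum {n m : ℕ} (h : n ≠ 0 ∨ m ≠ 0) :
    rookWalkCount 2 ![n, m] =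
      ∑ k ∈ Finset.range n, rookWalkCount 2 ![k, m] +
        ∑ k ∈ Finset.range m, rookWalkCount 2 ![n, k] := by
  have hv : (![n, m] : Fin 2 → ℕ) ≠ 0 := by
    intro h0
    have h1 := congrFun h0 0
    have h2 := congrFun h0 1
    simp at h1 h2
    omega
  rw [rookWalkCount_eq_sum hv, Fin.sum_univ_two]
  have e0 (k : ℕ) : Function.update ![n, m] 0 k = ![k, m] := by
    ext i; fin_cases i <;> simp
  have e1 (k : ℕ) : Function.update ![n, m] 1 k = ![n, k] := by
    ext i; fin_cases i <;> simp
  simp [e0, e1]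

/-- The sum of the two-dimensional rook walk numbers over the rectangle `[0, n] × [0, m]`. -/
noncomputable def rookRectSum (n m : ℕ) : ℝ :=
  ∑ i ∈ Finset.range (n + 1), ∑ j ∈ Finset.range (m + 1), (rookWalkCount 2 ![i, j] : ℝ)

theorem rookRectSum_succ_left (n m : ℕ) :
    rookRectSum (n + 1) m =
      rookRectSum n m + ∑ j ∈ Finset.range (m + 1), (rookWalkCount 2 ![n + 1, j] : ℝ) := by
  rw [rookRectSum, Finset.sum_range_succ, rookRectSum]

theorem rookRectSum_succ_right (n m : ℕ) :
    rookRectSum n (m + 1) =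
      rookRectSum n m + ∑ i ∈ Finset.range (n + 1), (rookWalkCount 2 ![i, m + 1] : ℝ) := by
  simp only [rookRectSum]
  rw [← Finset.sum_add_distrib]
  exact Finset.sum_congr rfl fun i _ => Finset.sum_range_succ _ _

theorem rookWalkCount_succ_succ (n m : ℕ) :
    (rookWalkCount 2 ![n + 1, m + 1] : ℝ) =
      rookRectSum (n + 1) (m + 1) - rookRectSum (n + 1) m - rookRectSum n (m + 1)
        + rookRectSum n m := by
  have h := rookRectSum_succ_left n (m + 1)
  rw [Finset.sum_range_succ] at h
  linarith [rookRectSum_succ_left n m]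

theorem rookRectSum_succ_succ (n m : ℕ) :
    rookRectSum (n + 1) (m + 1) =
      2 * rookRectSum n (m + 1) + 2 * rookRectSum (n + 1) m - 3 * rookRectSum n m := by
  have h : (rookWalkCount 2 ![n + 1, m + 1] : ℝ) = _ :=
    congrArg Nat.cast (rookWalkCount_two_eq_sum (Or.inl n.succ_ne_zero))
  push_cast at h
  linarith [rookWalkCount_succ_succ n m, rookRectSum_succ_left n m, rookRectSum_succ_right n m]

theorem rookRectSum_zero_zero : rookRectSum 0 0 = 1 := by
  have h : (![0, 0] : Fin 2 → ℕ) = 0 := by ext i; fin_cases i <;> rfl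
  simp [rookRectSum, h, rookWalkCount_zero]

theorem rookRectSum_zero_right (n : ℕ) : rookRectSum n 0 = 2 ^ n := by
  induction n with
  | zero => rw [rookRectSum_zero_zero, pow_zero]
  | succ n ih =>
    have h : (rookWalkCount 2 ![n + 1, 0] : ℝ) = _ :=
      congrArg Nat.cast (rookWalkCount_two_eq_sum (Or.inl n.succ_ne_zero))
    push_cast at h
    have h' : rookRectSum n 0 = ∑ k ∈ Finset.range (n + 1), (rookWalkCount 2 ![k, 0] : ℝ) := by
      simp [rookRectSum]
    rw [rookRectSum_succ_left, zero_add, Finset.sum_range_one, h, Finset.sum_range_zero, ← h',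
      ih, pow_succ]
    ring

theorem rookRectSum_zero_left (m : ℕ) : rookRectSum 0 m = 2 ^ m := by
  induction m with
  | zero => rw [rookRectSum_zero_zero, pow_zero]
  | succ m ih =>
    have h : (rookWalkCount 2 ![0, m + 1] : ℝ) = _ :=
      congrArg Nat.cast (rookWalkCount_two_eq_sum (Or.inr m.succ_ne_zero))
    push_cast at h
    have h' : rookRectSum 0 m = ∑ k ∈ Finset.range (m + 1), (rookWalkCount 2 ![0, k] : ℝ) := by
      simp [rookRectSum]
    rw [rookRectSum_succ_right, zero_add, Finset.sum_range_one, h, Finset.sum_range_zero, ← h',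
      ih, pow_succ]
    ring

theorem rookRectSum_comm (n m : ℕ) : rookRectSum n m = rookRectSum m n := by
  induction n generalizing m with
  | zero => rw [rookRectSum_zero_left, rookRectSum_zero_right]
  | succ n ih =>
    induction m with
    | zero => rw [rookRectSum_zero_left, rookRectSum_zero_right]
    | succ m ihm =>
      rw [rookRectSum_succ_succ, rookRectSum_succ_succ, ih, ih, ihm]
      ring

theorem rookRectSum_one_right (n : ℕ) : 2 * rookRectSum n 1 = (n + 4) * 2 ^ n := by
  induction n with
  | zero => rw [rookRectSum_zero_left]; norm_num
  | succ n ih =>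
    have h := rookRectSum_succ_succ n 0
    rw [rookRectSum_zero_right, rookRectSum_zero_right, zero_add] at h
    push_cast
    rw [pow_succ] at h ⊢
    linarith

/-- Coefficient form of the equation `(2 - 3 x) ∂F/∂x = (2 - 3 y) ∂F/∂y`
for `F = 1 / (1 - 2 x - 2 y + 3 x y)`. -/
theorem rookRectSum_contiguous (n m : ℕ) :
    2 * (n + 1) * rookRectSum (n + 1) m - 2 * (m + 1) * rookRectSum n (m + 1) =
      3 * (n - m) * rookRectSum n m := by
  have boundary (n : ℕ) :
      2 * (n + 1) * rookRectSum (n + 1) 0 - 2 * rookRectSum n 1 = 3 * n * rookRectSum n 0 := by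
    rw [rookRectSum_one_right, rookRectSum_zero_right, rookRectSum_zero_right, pow_succ]
    ring
  induction n generalizing m with
  | zero =>
    have h := boundary m
    rw [rookRectSum_comm (m + 1), rookRectSum_comm m, rookRectSum_comm m] at h
    push_cast
    rw [zero_add]
    linear_combination -h
  | succ n ih =>
    induction m with
    | zero =>
      have h := boundary (n + 1)
      push_cast at h ⊢
      rw [zero_add]
      linear_combination h
    | succ m ihm =>
      have h := ih (m + 1)
      have h0 := ih m
      push_cast at h h0 ihm ⊢
      linear_combination 2 * h + 2 * ihm - 3 * h0 +
        2 * ((n : ℝ) + 2) * rookRectSum_succ_succ (n + 1) m -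
        2 * ((m : ℝ) + 2) * rookRectSum_succ_succ n (m + 1)
        - 3 * ((n : ℝ) - m) * rookRectSum_succ_succ n m

theorem rookRectSum_diag_recurrence (n : ℕ) :
    ((n : ℝ) + 2) * rookRectSum (n + 2) (n + 2) =
      5 * (2 * n + 3) * rookRectSum (n + 1) (n + 1) - 9 * (n + 1) * rookRectSum n n := by
  have h1 := rookRectSum_succ_succ n n
  have h2 := rookRectSum_succ_succ (n + 1) (n + 1)
  have h3 := rookRectSum_succ_succ n (n + 1)
  have h4 := rookRectSum_contiguous n (n + 1)
  rw [rookRectSum_comm (n + 1) n] at h1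
  rw [rookRectSum_comm (n + 1 + 1) (n + 1)] at h2
  push_cast at h4
  linear_combination ((n : ℝ) + 2) * h2 + 4 * ((n : ℝ) + 2) * h3 - 4 * h4
    + 3 * ((n : ℝ) + 1) * h1

theorem two_mul_rookWalkCount_diag_succ (n : ℕ) :
    2 * (rookWalkCount 2 (fun _ => n + 1) : ℝ) =
      rookRectSum (n + 1) (n + 1) - rookRectSum n n := by
  have h : (fun _ => n + 1 : Fin 2 → ℕ) = ![n + 1, n + 1] := by
    ext i; fin_cases i <;> rfl
  rw [h, rookWalkCount_succ_succ]
  have h1 := rookRectSum_succ_succ n n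
  rw [rookRectSum_comm (n + 1) n] at h1 ⊢
  linarith

/-- The coefficient `4⁻ⁿ (2n choose n)` of `xⁿ` in `(1 - x) ^ (-1/2)`. -/
noncomputable def invSqrtCoeff (n : ℕ) : ℝ := n.centralBinom / 4 ^ n

theorem invSqrtCoeff_zero : invSqrtCoeff 0 = 1 := by simp [invSqrtCoeff]

theorem invSqrtCoeff_pos (n : ℕ) : 0 < invSqrtCoeff n :=
  div_pos (Nat.cast_pos.2 n.centralBinom_pos) (by positivity)

theorem invSqrtCoeff_le_one (n : ℕ) : invSqrtCoeff n ≤ 1 :=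
  div_le_one_of_le₀ (mod_cast n.centralBinom_le_four_pow) (by positivity)

theorem invSqrtCoeff_succ (n : ℕ) :
    2 * ((n : ℝ) + 1) * invSqrtCoeff (n + 1) = (2 * n + 1) * invSqrtCoeff n := by
  have h : ((n : ℝ) + 1) * (n + 1).centralBinom = 2 * (2 * n + 1) * n.centralBinom :=
    mod_cast n.succ_mul_centralBinom_succ
  rw [invSqrtCoeff, invSqrtCoeff, pow_succ]
  field_simp
  linear_combination 2 * h

/-- The power series of `(1 - c x) ^ (-1/2)`. -/
noncomputable def invSqrtSeries (c : ℝ) : PowerSeries ℝ :=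
  PowerSeries.mk fun n => invSqrtCoeff n * c ^ n

open PowerSeries in
theorem derivative_invSqrtSeries (c : ℝ) :
    2 * ((1 - C c * X) * d⁄dX ℝ (invSqrtSeries c)) = C c * invSqrtSeries c := by
  rw [← map_ofNat (C (R := ℝ)) 2]
  ext n
  rw [sub_mul, one_mul, mul_assoc, coeff_C_mul, coeff_C_mul, map_sub, coeff_C_mul]
  have h := invSqrtCoeff_succ n
  cases n with
  | zero =>
    simp only [coeff_zero_X_mul, coeff_derivative, invSqrtSeries, coeff_mk] at h ⊢
    push_cast at h ⊢
    linear_combination c * h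
  | succ n =>
    simp only [coeff_succ_X_mul, coeff_derivative, invSqrtSeries, coeff_mk] at h ⊢
    push_cast at h ⊢
    linear_combination c ^ (n + 2) * h

open PowerSeries in
theorem constantCoeff_invSqrtSeries (c : ℝ) : constantCoeff (invSqrtSeries c) = 1 := by
  rw [← coeff_zero_eq_constantCoeff_apply]
  simp [invSqrtSeries, invSqrtCoeff_zero]

open PowerSeries in
theorem invSqrtSeries_sq_mul (c : ℝ) : invSqrtSeries c ^ 2 * (1 - C c * X) = 1 := by
  apply derivative.ext
  · simp only [Derivation.leibniz, Derivation.leibniz_pow, map_sub, Derivation.map_one_eq_zero,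
      derivative_C, derivative_X, smul_eq_mul, nsmul_eq_mul]
    linear_combination (invSqrtSeries c) * derivative_invSqrtSeries c
  · simp [constantCoeff_invSqrtSeries]

/-- The generating function of the diagonal rectangle sums `rookRectSum n n`. -/
noncomputable def rookDiagSeries : PowerSeries ℝ :=
  PowerSeries.mk fun n => rookRectSum n n

open PowerSeries in
theorem derivative_rookDiagSeries :
    (1 - C 10 * X + C 9 * (X * X)) * d⁄dX ℝ rookDiagSeries =
      C 5 * rookDiagSeries - C 9 * (X * rookDiagSeries) := by
  ext n
  simp only [add_mul, sub_mul, one_mul, mul_assoc, map_add, map_sub, coeff_C_mul]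
  match n with
  | 0 =>
    have h := rookRectSum_succ_succ 0 0
    have h1 := rookRectSum_zero_left 1
    have h2 := rookRectSum_zero_right 1
    have h3 := rookRectSum_zero_left 0
    simp only [zero_add, pow_one, pow_zero] at h h1 h2 h3
    simp [coeff_derivative, rookDiagSeries, h, h1, h2, h3]
    norm_num
  | 1 =>
    have h := rookRectSum_diag_recurrence 0
    simp only [coeff_succ_X_mul, coeff_zero_X_mul, coeff_derivative, rookDiagSeries, coeff_mk,
      zero_add, CharP.cast_eq_zero, Nat.cast_one] at h ⊢
    linear_combination h
  | n + 2 =>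
    have h := rookRectSum_diag_recurrence (n + 1)
    simp only [coeff_succ_X_mul, coeff_derivative, rookDiagSeries, coeff_mk] at h ⊢
    push_cast at h ⊢
    linear_combination h

open PowerSeries in
theorem constantCoeff_rookDiagSeries : constantCoeff rookDiagSeries = 1 := by
  rw [← coeff_zero_eq_constantCoeff_apply, rookDiagSeries, coeff_mk, rookRectSum_zero_zero]

open PowerSeries in
theorem rookDiagSeries_sq_mul :
    rookDiagSeries ^ 2 * (1 - C 10 * X + C 9 * (X * X)) = 1 := by
  apply derivative.ext
  · simp only [Derivation.leibniz, Derivation.leibniz_pow, map_sub, map_add,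
      Derivation.map_one_eq_zero, derivative_C, derivative_X, smul_eq_mul, nsmul_eq_mul]
    have h10 : (C 10 : PowerSeries ℝ) = 2 * C 5 := by
      rw [← map_ofNat (C (R := ℝ)) 2, ← map_mul]; norm_num
    push_cast
    linear_combination 2 * rookDiagSeries * derivative_rookDiagSeries - rookDiagSeries ^ 2 * h10
  · simp [constantCoeff_rookDiagSeries]

open PowerSeries in
theorem rookDiagSeries_eq_mul : rookDiagSeries = invSqrtSeries 9 * invSqrtSeries 1 := by
  have h9 := invSqrtSeries_sq_mul 9
  have h1 := invSqrtSeries_sq_mul 1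
  have hC : (C 10 : PowerSeries ℝ) = C 9 + C 1 := by rw [← map_add]; norm_num
  have hp : (1 - C 9 * X) * (1 - C 1 * X) = (1 - C 10 * X + C 9 * (X * X) : PowerSeries ℝ) := by
    rw [hC, map_one]; ring
  have hsq : rookDiagSeries ^ 2 = (invSqrtSeries 9 * invSqrtSeries 1) ^ 2 := by
    have hd := rookDiagSeries_sq_mul
    rw [← hp] at hd
    linear_combination (invSqrtSeries 9 * invSqrtSeries 1) ^ 2 * hd
      - rookDiagSeries ^ 2 * (invSqrtSeries 1 ^ 2 * (1 - C 1 * X)) * h9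
      - rookDiagSeries ^ 2 * h1
  refine (sq_eq_sq_iff_eq_or_eq_neg.1 hsq).resolve_right fun h => ?_
  have := congrArg constantCoeff h
  simp only [map_neg, map_mul, constantCoeff_rookDiagSeries, constantCoeff_invSqrtSeries] at this
  norm_num at this

/-- The coefficient of `xⁿ` in `(1 - x) ^ (1/2)`. -/
noncomputable def sqrtCoeff (n : ℕ) : ℝ :=
  PowerSeries.coeff n ((1 - PowerSeries.X) * invSqrtSeries 1)

theorem sqrtCoeff_zero : sqrtCoeff 0 = 1 := by
  simp [sqrtCoeff, constantCoeff_invSqrtSeries]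

theorem sqrtCoeff_succ (n : ℕ) :
    sqrtCoeff (n + 1) = invSqrtCoeff (n + 1) - invSqrtCoeff n := by
  simp [sqrtCoeff, sub_mul, invSqrtSeries, PowerSeries.coeff_succ_X_mul]

theorem abs_sqrtCoeff_le_one (n : ℕ) : |sqrtCoeff n| ≤ 1 := by
  cases n with
  | zero => simp [sqrtCoeff_zero]
  | succ n =>
    rw [sqrtCoeff_succ, abs_le]
    constructor <;> linarith [invSqrtCoeff_pos n, invSqrtCoeff_pos (n + 1),
      invSqrtCoeff_le_one n, invSqrtCoeff_le_one (n + 1)]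

open PowerSeries in
theorem two_mul_rookWalkCount_diag_eq_sum {n : ℕ} (hn : n ≠ 0) :
    2 * (rookWalkCount 2 (fun _ => n) : ℝ) =
      ∑ j ∈ Finset.range (n + 1), sqrtCoeff j * (invSqrtCoeff (n - j) * 9 ^ (n - j)) := by
  obtain ⟨m, rfl⟩ := Nat.exists_eq_succ_of_ne_zero hn
  have h : (1 - X) * rookDiagSeries = (1 - X) * invSqrtSeries 1 * invSqrtSeries 9 := by
    rw [rookDiagSeries_eq_mul]; ring
  have hc := congrArg (coeff (m + 1)) h
  rw [sub_mul 1 X rookDiagSeries, one_mul, map_sub, coeff_succ_X_mul, coeff_mul,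
    Finset.Nat.sum_antidiagonal_eq_sum_range_succ_mk] at hc
  simp only [rookDiagSeries, invSqrtSeries, coeff_mk] at hc
  rw [Nat.succ_eq_add_one, two_mul_rookWalkCount_diag_succ, hc]
  rfl

/-- The ratio of the coefficients of indices `n - j` and `n`, extended by zero to `j > n`. -/
noncomputable def invSqrtCoeffRatio (n j : ℕ) : ℝ :=
  if j ≤ n then invSqrtCoeff (n - j) / invSqrtCoeff n else 0

theorem invSqrtCoeffRatio_zero (n : ℕ) : invSqrtCoeffRatio n 0 = 1 := by
  simp [invSqrtCoeffRatio, (invSqrtCoeff_pos n).ne']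

theorem invSqrtCoeffRatio_succ {n j : ℕ} (h : j + 1 ≤ n) :
    invSqrtCoeffRatio n (j + 1) =
      invSqrtCoeffRatio n j + invSqrtCoeffRatio n j / (2 * (n - j) - 1) := by
  obtain ⟨k, rfl⟩ := Nat.exists_eq_add_of_le h
  have hB := invSqrtCoeff_succ k
  have h0 := (invSqrtCoeff_pos (j + 1 + k)).ne'
  rw [invSqrtCoeffRatio, invSqrtCoeffRatio, if_pos h, if_pos (by omega),
    show j + 1 + k - (j + 1) = k by omega, show j + 1 + k - j = k + 1 by omega]
  push_cast
  rw [show (2 * ((j : ℝ) + 1 + k - j) - 1) = 2 * k + 1 by ring]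
  have h1 : (2 * (k : ℝ) + 1) ≠ 0 := by positivity
  field_simp
  linear_combination -hB

theorem invSqrtCoeffRatio_bounds {n j : ℕ} (h : j ≤ n) :
    1 ≤ invSqrtCoeffRatio n j ∧ invSqrtCoeffRatio n j ≤ 2 ^ j ∧
      n * (invSqrtCoeffRatio n j - 1) ≤ j ^ 2 * 2 ^ j := by
  induction j with
  | zero => simp [invSqrtCoeffRatio_zero]
  | succ j ih =>
    obtain ⟨h1, h2, h3⟩ := ih (by omega)
    rw [invSqrtCoeffRatio_succ h]
    have hnj : (j : ℝ) + 1 ≤ n := mod_cast h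
    have hd : 1 ≤ 2 * ((n : ℝ) - j) - 1 := by linarith
    have hd0 : 0 < 2 * ((n : ℝ) - j) - 1 := by linarith
    have hle : invSqrtCoeffRatio n j / (2 * ((n : ℝ) - j) - 1) ≤ invSqrtCoeffRatio n j :=
      div_le_self (by linarith) hd
    have hn : (n : ℝ) / (2 * ((n : ℝ) - j) - 1) ≤ j + 1 := by
      rw [div_le_iff₀ hd0]
      nlinarith [(Nat.cast_nonneg j : (0 : ℝ) ≤ j)]
    have hmul : n * (invSqrtCoeffRatio n j / (2 * ((n : ℝ) - j) - 1)) ≤ (j + 1) * 2 ^ j := by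
      rw [mul_div_left_comm, mul_comm]
      exact mul_le_mul hn h2 (by linarith) (by positivity)
    refine ⟨?_, ?_, ?_⟩
    · have : 0 ≤ invSqrtCoeffRatio n j / (2 * ((n : ℝ) - j) - 1) :=
        div_nonneg (by linarith) hd0.le
      linarith
    · rw [pow_succ]; linarith
    · rw [pow_succ (2 : ℝ) j]
      push_cast
      have h2j : (0 : ℝ) < 2 ^ j := by positivity
      nlinarith [mul_nonneg (Nat.cast_nonneg j : (0 : ℝ) ≤ j) h2j.le,
        mul_nonneg (sq_nonneg (j : ℝ)) h2j.le]

theorem abs_mul_invSqrtCoeffRatio_sub_one_le (n j : ℕ) :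
    |n * (invSqrtCoeffRatio n j - 1)| ≤ j ^ 2 * 2 ^ j := by
  rcases le_or_gt j n with h | h
  · obtain ⟨h1, -, h3⟩ := invSqrtCoeffRatio_bounds h
    rwa [abs_of_nonneg (mul_nonneg (Nat.cast_nonneg n) (by linarith))]
  · rw [invSqrtCoeffRatio, if_neg (by omega), zero_sub, mul_neg_one, abs_neg, Nat.abs_cast]
    have : n ≤ j ^ 2 * 2 ^ j := by
      calc n ≤ j := h.le
        _ ≤ j ^ 2 := Nat.le_self_pow two_ne_zero j
        _ ≤ j ^ 2 * 2 ^ j := Nat.le_mul_of_pos_right _ (by positivity)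
    exact_mod_cast this

theorem tendsto_one_of_tendsto_mul_sub_one {u : ℕ → ℝ} {c : ℝ}
    (h : Tendsto (fun n : ℕ => (n : ℝ) * (u n - 1)) atTop (nhds c)) :
    Tendsto u atTop (nhds 1) := by
  have h' := (h.mul tendsto_inv_atTop_nhds_zero_nat).add_const 1
  rw [mul_zero, zero_add] at h'
  refine h'.congr' ?_
  filter_upwards [eventually_ne_atTop 0] with n hn
  have : (n : ℝ) ≠ 0 := Nat.cast_ne_zero.2 hn
  field_simp
  ring

theorem tendsto_mul_invSqrtCoeffRatio_sub_one (j : ℕ) :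
    Tendsto (fun n : ℕ => (n : ℝ) * (invSqrtCoeffRatio n j - 1)) atTop (nhds (j / 2)) := by
  induction j with
  | zero => simp [invSqrtCoeffRatio_zero]
  | succ j ih =>
    have hr := tendsto_one_of_tendsto_mul_sub_one ih
    have hq : Tendsto (fun n : ℕ => ((2 : ℝ) - (2 * j + 1) * (n : ℝ)⁻¹)⁻¹) atTop
        (nhds (1 / 2)) := by
      have := ((tendsto_inv_atTop_nhds_zero_nat (𝕜 := ℝ)).const_mul (2 * (j : ℝ) + 1)).const_sub 2
      rw [mul_zero, sub_zero] at this
      simpa using this.inv₀ two_ne_zero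
    have h := ih.add (hr.mul hq)
    rw [show (j : ℝ) / 2 + 1 * (1 / 2) = ((j + 1 : ℕ) : ℝ) / 2 by push_cast; ring] at h
    refine h.congr' ?_
    filter_upwards [eventually_ge_atTop (j + 1)] with n hn
    have hnj : (j : ℝ) + 1 ≤ n := mod_cast hn
    have hn0 : (0 : ℝ) < n := by linarith [(Nat.cast_nonneg j : (0 : ℝ) ≤ j)]
    rw [invSqrtCoeffRatio_succ hn]
    have e : ((2 : ℝ) - (2 * j + 1) * (n : ℝ)⁻¹)⁻¹ = n / (2 * (n - j) - 1) := by
      rw [← inv_div]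
      congr 1
      field_simp
      ring
    rw [e]
    ring

theorem summable_sq_mul_two_pow_mul : Summable fun j : ℕ => (j : ℝ) ^ 2 * 2 ^ j * (1 / 9) ^ j := by
  have h := summable_pow_mul_geometric_of_norm_lt_one (R := ℝ) 2 (r := 2 / 9) (by norm_num)
  refine h.congr fun j => ?_
  rw [mul_assoc, ← mul_pow]
  norm_num

theorem summable_mul_geometric_of_abs_le_one {c : ℕ → ℝ} (hc : ∀ j, |c j| ≤ 1) :
    Summable fun j => c j * (1 / 9 : ℝ) ^ j := by
  refine Summable.of_norm_bounded
    (summable_geometric_of_lt_one (r := (1 / 9 : ℝ)) (by norm_num) (by norm_num)) fun j => ?_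
  rw [norm_mul, Real.norm_eq_abs, norm_pow, Real.norm_of_nonneg (by norm_num : (0 : ℝ) ≤ 1 / 9)]
  exact mul_le_of_le_one_left (by positivity) (hc j)

/-- Expansion to second order of the Cauchy product of `invSqrtCoeff` with a sequence that decays
like `9⁻ʲ`. -/
theorem tendsto_mul_sum_invSqrtCoeffRatio_sub {c : ℕ → ℝ} (hc : ∀ j, |c j| ≤ 1) :
    Tendsto (fun n : ℕ => (n : ℝ) *
      (∑ j ∈ Finset.range (n + 1), c j * (1 / 9) ^ j * invSqrtCoeffRatio n j -
        ∑' j, c j * (1 / 9) ^ j)) atTop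
      (nhds (∑' j : ℕ, (j / 2 : ℝ) * (c j * (1 / 9) ^ j))) := by
  have hlim := tendsto_tsum_of_dominated_convergence (𝓕 := atTop)
    (f := fun (n j : ℕ) => (n : ℝ) * (invSqrtCoeffRatio n j - 1) * (c j * (1 / 9 : ℝ) ^ j))
    summable_sq_mul_two_pow_mul
    (fun j => (tendsto_mul_invSqrtCoeffRatio_sub_one j).mul_const (c j * (1 / 9 : ℝ) ^ j))
    (Eventually.of_forall fun n j => by
      rw [norm_mul, norm_mul (c j), norm_pow, Real.norm_eq_abs, Real.norm_eq_abs,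
        Real.norm_of_nonneg (by norm_num : (0 : ℝ) ≤ 1 / 9)]
      exact mul_le_mul (abs_mul_invSqrtCoeffRatio_sub_one_le n j)
        (mul_le_of_le_one_left (by positivity) (hc j)) (by positivity) (by positivity))
  refine hlim.congr fun n => ?_
  have hvanish : ∀ j ∉ Finset.range (n + 1), c j * (1 / 9 : ℝ) ^ j * invSqrtCoeffRatio n j = 0 := by
    intro j hj
    rw [Finset.mem_range] at hj
    rw [invSqrtCoeffRatio, if_neg (by omega), mul_zero]
  rw [← tsum_eq_sum (L := .unconditional ℕ) hvanish,
    ← (summable_of_ne_finset_zero hvanish).tsum_sub (summable_mul_geometric_of_abs_le_one hc),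
    ← tsum_mul_left]
  exact tsum_congr fun j => by ring

open PowerSeries in
theorem sum_antidiagonal_invSqrtCoeff_mul (c : ℝ) (n : ℕ) :
    ∑ p ∈ Finset.HasAntidiagonal.antidiagonal n,
      invSqrtCoeff p.1 * c ^ p.1 * (invSqrtCoeff p.2 * c ^ p.2) = c ^ n := by
  have hcoeff (n : ℕ) : coeff n (invSqrtSeries c ^ 2) = c ^ n := by
    have h := invSqrtSeries_sq_mul c
    induction n with
    | zero => simp [constantCoeff_invSqrtSeries]
    | succ n ih =>
      have hn := congrArg (coeff (n + 1)) h
      rw [mul_sub, mul_one, mul_left_comm, map_sub, coeff_C_mul, coeff_succ_mul_X, ih] at hn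
      simp only [coeff_one, Nat.succ_ne_zero, if_false] at hn
      linear_combination hn
  rw [← hcoeff n, sq, coeff_mul]
  simp [invSqrtSeries]

theorem summable_invSqrtCoeff_mul : Summable fun j => invSqrtCoeff j * (1 / 9 : ℝ) ^ j :=
  summable_mul_geometric_of_abs_le_one fun j => by
    rw [abs_of_pos (invSqrtCoeff_pos j)]
    exact invSqrtCoeff_le_one j

theorem tsum_invSqrtCoeff_sq : (∑' j, invSqrtCoeff j * (1 / 9 : ℝ) ^ j) ^ 2 = 9 / 8 := by
  have hs : Summable fun j => ‖invSqrtCoeff j * (1 / 9 : ℝ) ^ j‖ :=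
    summable_invSqrtCoeff_mul.norm
  rw [sq, tsum_mul_tsum_eq_tsum_sum_antidiagonal_of_summable_norm hs hs]
  simp only [sum_antidiagonal_invSqrtCoeff_mul]
  rw [tsum_geometric_of_lt_one (by norm_num) (by norm_num)]
  norm_num

theorem summable_sqrtCoeff_mul : Summable fun j => sqrtCoeff j * (1 / 9 : ℝ) ^ j :=
  summable_mul_geometric_of_abs_le_one abs_sqrtCoeff_le_one

theorem tsum_sqrtCoeff : ∑' j, sqrtCoeff j * (1 / 9 : ℝ) ^ j = √(8 / 9) := by
  have hsum : ∑' j, sqrtCoeff j * (1 / 9 : ℝ) ^ j =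
      8 / 9 * ∑' j, invSqrtCoeff j * (1 / 9 : ℝ) ^ j := by
    have hB := summable_invSqrtCoeff_mul
    have hB' := (summable_nat_add_iff 1).2 hB
    rw [summable_sqrtCoeff_mul.tsum_eq_zero_add]
    have e (j : ℕ) : sqrtCoeff (j + 1) * (1 / 9 : ℝ) ^ (j + 1) =
        invSqrtCoeff (j + 1) * (1 / 9) ^ (j + 1) - 1 / 9 * (invSqrtCoeff j * (1 / 9) ^ j) := by
      rw [sqrtCoeff_succ]; ring
    simp only [e]
    rw [hB'.tsum_sub (hB.mul_left _), tsum_mul_left]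
    have h := hB.tsum_eq_zero_add
    rw [invSqrtCoeff_zero] at h
    rw [sqrtCoeff_zero]
    linarith
  have hnonneg : 0 ≤ ∑' j, invSqrtCoeff j * (1 / 9 : ℝ) ^ j :=
    tsum_nonneg fun j => mul_nonneg (invSqrtCoeff_pos j).le (by positivity)
  rw [hsum, eq_comm, Real.sqrt_eq_iff_mul_self_eq (by norm_num) (by positivity), eq_comm]
  linear_combination 64 / 81 * tsum_invSqrtCoeff_sq

theorem sqrtCoeff_recurrence (j : ℕ) :
    2 * ((j : ℝ) + 1) * sqrtCoeff (j + 1) = (2 * j - 1) * sqrtCoeff j := by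
  have h := invSqrtCoeff_succ j
  cases j with
  | zero =>
    rw [sqrtCoeff_succ, sqrtCoeff_zero]
    rw [invSqrtCoeff_zero] at h ⊢
    push_cast at h ⊢
    linarith
  | succ j =>
    have h' := invSqrtCoeff_succ j
    rw [sqrtCoeff_succ, sqrtCoeff_succ]
    push_cast at h ⊢
    linear_combination h - h'

theorem tsum_half_mul_sqrtCoeff :
    ∑' j : ℕ, (j / 2 : ℝ) * (sqrtCoeff j * (1 / 9) ^ j) = -√(8 / 9) / 32 := by
  have hs : Summable fun j : ℕ => (j / 2 : ℝ) * (sqrtCoeff j * (1 / 9) ^ j) := by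
    have h := summable_pow_mul_geometric_of_norm_lt_one (R := ℝ) 1 (r := 1 / 9) (by norm_num)
    refine Summable.of_norm_bounded h fun j => ?_
    rw [norm_mul, norm_mul (sqrtCoeff j), norm_pow,
      Real.norm_of_nonneg (by norm_num : (0 : ℝ) ≤ 1 / 9),
      Real.norm_of_nonneg (by positivity : (0 : ℝ) ≤ j / 2), Real.norm_eq_abs, pow_one]
    exact mul_le_mul (half_le_self (Nat.cast_nonneg j))
      (mul_le_of_le_one_left (by positivity) (abs_sqrtCoeff_le_one j)) (by positivity)
      (Nat.cast_nonneg j)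
  have h := hs.tsum_eq_zero_add
  have e (j : ℕ) : ((j + 1 : ℕ) / 2 : ℝ) * (sqrtCoeff (j + 1) * (1 / 9) ^ (j + 1)) =
      1 / 9 * ((j / 2 : ℝ) * (sqrtCoeff j * (1 / 9) ^ j)) -
        1 / 36 * (sqrtCoeff j * (1 / 9 : ℝ) ^ j) := by
    push_cast
    linear_combination (1 / 9 : ℝ) ^ (j + 1) / 4 * sqrtCoeff_recurrence j
  simp only [e] at h
  rw [(hs.mul_left _).tsum_sub (summable_sqrtCoeff_mul.mul_left _), tsum_mul_left, tsum_mul_left,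
    tsum_sqrtCoeff] at h
  push_cast at h
  linarith

theorem invSqrtCoeff_sq_mul_wallis (n : ℕ) :
    invSqrtCoeff n ^ 2 * (Real.Wallis.W n * (2 * n + 1)) = 1 := by
  induction n with
  | zero => simp [invSqrtCoeff_zero, Real.Wallis.W]
  | succ n ih =>
    have h : invSqrtCoeff (n + 1) = (2 * n + 1) / (2 * (n + 1)) * invSqrtCoeff n := by
      have := invSqrtCoeff_succ n
      field_simp
      linarith
    refine Eq.trans ?_ ih
    rw [h, Real.Wallis.W_succ]
    push_cast
    field_simp
    ring

theorem tendsto_pi_mul_invSqrtCoeff_sq :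
    Tendsto (fun n : ℕ => π * n * invSqrtCoeff n ^ 2) atTop (nhds 1) := by
  have hW := Real.Wallis.tendsto_W_nhds_pi_div_two.inv₀ (by positivity)
  have hn : Tendsto (fun n : ℕ => ((2 : ℝ) + (n : ℝ)⁻¹)⁻¹) atTop (nhds (2 : ℝ)⁻¹) := by
    have := (tendsto_inv_atTop_nhds_zero_nat (𝕜 := ℝ)).const_add 2
    rw [add_zero] at this
    exact this.inv₀ two_ne_zero
  have h := (hW.mul hn).const_mul π
  rw [show π * ((π / 2)⁻¹ * 2⁻¹) = 1 by field_simp] at h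
  refine h.congr' ?_
  filter_upwards [eventually_ne_atTop 0] with n hn0
  have hn' : (n : ℝ) ≠ 0 := Nat.cast_ne_zero.2 hn0
  have hWn := (Real.Wallis.W_pos n).ne'
  have hB : invSqrtCoeff n ^ 2 = (Real.Wallis.W n * (2 * n + 1))⁻¹ :=
    eq_inv_of_mul_eq_one_left (invSqrtCoeff_sq_mul_wallis n)
  rw [hB]
  field_simp

theorem pi_mul_invSqrtCoeff_sq_succ (n : ℕ) :
    4 * (n : ℝ) * (n + 1) * (π * (n + 1 : ℕ) * invSqrtCoeff (n + 1) ^ 2) =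
      (2 * n + 1) ^ 2 * (π * n * invSqrtCoeff n ^ 2) := by
  push_cast
  linear_combination π * n * (2 * (n + 1) * invSqrtCoeff (n + 1) + (2 * n + 1) * invSqrtCoeff n) *
    invSqrtCoeff_succ n

/-- Second-order bounds for the central binomial coefficients. -/
theorem pi_mul_invSqrtCoeff_sq_bounds {n : ℕ} (hn : 1 ≤ n) :
    1 - 1 / (4 * n) ≤ π * n * invSqrtCoeff n ^ 2 ∧
      π * n * invSqrtCoeff n ^ 2 * (1 + 1 / (4 * n)) ≤ 1 := by
  set w : ℕ → ℝ := fun n => π * n * invSqrtCoeff n ^ 2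
  have hlim : Tendsto (fun k : ℕ => w (n + k)) atTop (nhds 1) := by
    simpa only [add_comm] using (tendsto_add_atTop_iff_nat n).2 tendsto_pi_mul_invSqrtCoeff_sq
  have hinv : Tendsto (fun k : ℕ => 1 / (4 * ((n + k : ℕ) : ℝ))) atTop (nhds 0) := by
    have := (tendsto_add_atTop_iff_nat n).2
      ((tendsto_inv_atTop_nhds_zero_nat (𝕜 := ℝ)).const_mul (1 / 4))
    rw [mul_zero] at this
    refine this.congr fun k => ?_
    rw [add_comm k n, one_div, one_div, mul_inv]
  have hpos (k : ℕ) : (0 : ℝ) < (n + k : ℕ) := by exact_mod_cast (by omega : 0 < n + k)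
  have hwpos (k : ℕ) : 0 < w (n + k) := by
    have := hpos k
    have := invSqrtCoeff_pos (n + k)
    positivity
  have hsucc (k : ℕ) : w (n + (k + 1)) =
      (2 * (n + k : ℕ) + 1) ^ 2 / (4 * (n + k : ℕ) * ((n + k : ℕ) + 1)) * w (n + k) := by
    have h := pi_mul_invSqrtCoeff_sq_succ (n + k)
    have := hpos k
    rw [div_mul_eq_mul_div, eq_div_iff (by positivity), mul_comm]
    exact h
  have hupper : Monotone fun k : ℕ => w (n + k) * (1 + 1 / (4 * ((n + k : ℕ) : ℝ))) := by
    refine monotone_nat_of_le_succ fun k => ?_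
    have hx := hpos k
    have hwk := hwpos k
    rw [hsucc k, ← add_assoc n k 1, Nat.cast_succ]
    generalize w (n + k) = y at *
    generalize ((n + k : ℕ) : ℝ) = x at *
    rw [mul_comm _ y, mul_assoc]
    refine mul_le_mul_of_nonneg_left ?_ hwk.le
    rw [← sub_nonneg]
    have : (2 * x + 1) ^ 2 / (4 * x * (x + 1)) * (1 + 1 / (4 * (x + 1))) - (1 + 1 / (4 * x)) =
        1 / (16 * x * (x + 1) ^ 2) := by
      field_simp
      ring
    rw [this]
    positivity
  have hU (k : ℕ) : w (n + k) * (1 + 1 / (4 * ((n + k : ℕ) : ℝ))) ≤ 1 :=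
    hupper.ge_of_tendsto (by simpa using hlim.mul (hinv.const_add 1)) k
  have hle (k : ℕ) : w (n + k) ≤ 1 := by
    refine le_trans (le_mul_of_one_le_right (hwpos k).le ?_) (hU k)
    have := hpos k
    rw [le_add_iff_nonneg_right]
    positivity
  have hlower : Antitone fun k : ℕ => w (n + k) + 1 / (4 * ((n + k : ℕ) : ℝ)) := by
    refine antitone_nat_of_succ_le fun k => ?_
    have hx := hpos k
    have hwk := hle k
    rw [hsucc k, ← add_assoc n k 1, Nat.cast_succ]
    generalize w (n + k) = y at *
    generalize ((n + k : ℕ) : ℝ) = x at *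
    rw [← sub_nonneg]
    have : y + 1 / (4 * x) - ((2 * x + 1) ^ 2 / (4 * x * (x + 1)) * y + 1 / (4 * (x + 1))) =
        (1 - y) / (4 * x * (x + 1)) := by
      field_simp
      ring
    rw [this]
    exact div_nonneg (by linarith) (by positivity)
  have hL : 1 ≤ w (n + 0) + 1 / (4 * ((n + 0 : ℕ) : ℝ)) :=
    hlower.le_of_tendsto (by simpa using hlim.add hinv) 0
  have hU0 := hU 0
  rw [add_zero] at hL hU0
  exact ⟨by linarith, hU0⟩

theorem tendsto_mul_pi_mul_invSqrtCoeff_sq_sub_one :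
    Tendsto (fun n : ℕ => (n : ℝ) * (π * n * invSqrtCoeff n ^ 2 - 1)) atTop (nhds (-1 / 4)) := by
  have hlim := tendsto_pi_mul_invSqrtCoeff_sq.const_mul (-1 / 4)
  rw [mul_one] at hlim
  refine tendsto_of_tendsto_of_tendsto_of_le_of_le' tendsto_const_nhds hlim ?_ ?_
  all_goals
    filter_upwards [eventually_ge_atTop 1] with n hn
    have hn0 : (0 : ℝ) < n := by exact_mod_cast hn
    obtain ⟨h1, h2⟩ := pi_mul_invSqrtCoeff_sq_bounds hn
    generalize π * n * invSqrtCoeff n ^ 2 = w at *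
  · have h := mul_le_mul_of_nonneg_left h1 hn0.le
    have e : (n : ℝ) * (1 - 1 / (4 * n)) = n - 1 / 4 := by field_simp
    linarith
  · have h := mul_le_mul_of_nonneg_left h2 hn0.le
    have e : (n : ℝ) * (w * (1 + 1 / (4 * n))) = n * w + w / 4 := by field_simp
    linarith

theorem tendsto_mul_sqrt_sub_one {w : ℕ → ℝ} {c : ℝ} (hw : ∀ n, 0 ≤ w n)
    (h : Tendsto (fun n : ℕ => (n : ℝ) * (w n - 1)) atTop (nhds c)) :
    Tendsto (fun n : ℕ => (n : ℝ) * (√(w n) - 1)) atTop (nhds (c / 2)) := by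
  have h1 := (tendsto_one_of_tendsto_mul_sub_one h).sqrt.add_const 1
  rw [Real.sqrt_one, one_add_one_eq_two] at h1
  refine (h.div h1 two_ne_zero).congr fun n => ?_
  have : √(w n) + 1 ≠ 0 := by positivity
  rw [Pi.div_apply, div_eq_iff this]
  linear_combination -(n : ℝ) * Real.sq_sqrt (hw n)

theorem rookWalkCount_diag_div_eq {n : ℕ} (hn : n ≠ 0) :
    (rookWalkCount 2 (fun _ => n) : ℝ) /
        (Real.sqrt (2 / (Real.pi * n)) * ((3 : ℝ) ^ (2 * n) / 3)) =
      √(π * n * invSqrtCoeff n ^ 2) *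
        ((∑ j ∈ Finset.range (n + 1), sqrtCoeff j * (1 / 9) ^ j * invSqrtCoeffRatio n j) /
          √(8 / 9)) := by
  have hn0 : (0 : ℝ) < n := by exact_mod_cast Nat.pos_of_ne_zero hn
  have hB := invSqrtCoeff_pos n
  have hsum : 2 * (rookWalkCount 2 (fun _ => n) : ℝ) = 9 ^ n * invSqrtCoeff n *
      ∑ j ∈ Finset.range (n + 1), sqrtCoeff j * (1 / 9) ^ j * invSqrtCoeffRatio n j := by
    rw [two_mul_rookWalkCount_diag_eq_sum hn, Finset.mul_sum]
    refine Finset.sum_congr rfl fun j hj => ?_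
    have hj' : j ≤ n := Nat.lt_succ_iff.1 (Finset.mem_range.1 hj)
    rw [invSqrtCoeffRatio, if_pos hj', pow_sub₀ _ (by norm_num) hj', one_div, inv_pow]
    field_simp
  have hcount := eq_div_of_mul_eq two_ne_zero ((mul_comm _ _).trans hsum)
  have h89 : √(8 / 9 : ℝ) = 2 / 3 * √2 := by
    rw [show (8 / 9 : ℝ) = (2 / 3) ^ 2 * 2 by norm_num, Real.sqrt_mul (by norm_num),
      Real.sqrt_sq (by norm_num)]
  have hpn : 0 < √(π * n) := Real.sqrt_pos.2 (by positivity)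
  have h2 : 0 < √(2 : ℝ) := by positivity
  rw [hcount, h89, Real.sqrt_div (by norm_num),
    Real.sqrt_mul (by positivity : 0 ≤ π * n),
    Real.sqrt_sq hB.le, pow_mul, show (3 : ℝ) ^ 2 = 9 by norm_num]
  field_simp

/-- Second-order asymptotic correction for diagonal 2-dimensional rook walk
numbers: `n·(a(n,n)/(√(2/(πn))·3^{2n−1}) − 1) → −5/32` as `n → ∞`. -/
theorem rook_two_dim_second_order_asymptotics :
    Filter.Tendsto
      (fun n : ℕ =>
        (n : ℝ) *
          ((rookWalkCount 2 (fun _ => n) : ℝ) /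
            (Real.sqrt (2 / (Real.pi * n)) * ((3 : ℝ) ^ (2 * n) / 3)) - 1))
      Filter.atTop (nhds (-5 / 32)) := by
  have hσ : √(8 / 9 : ℝ) ≠ 0 := by positivity
  have hsqrt := tendsto_mul_sqrt_sub_one (fun n => by positivity)
    tendsto_mul_pi_mul_invSqrtCoeff_sq_sub_one
  have hsum := (tendsto_mul_sum_invSqrtCoeffRatio_sub abs_sqrtCoeff_le_one).div_const √(8 / 9)
  rw [tsum_half_mul_sqrtCoeff, tsum_sqrtCoeff] at hsum
  have hR : Tendsto (fun n : ℕ => (n : ℝ) *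
      ((∑ j ∈ Finset.range (n + 1), sqrtCoeff j * (1 / 9) ^ j * invSqrtCoeffRatio n j) /
        √(8 / 9) - 1)) atTop (nhds (-1 / 32)) := by
    convert hsum using 2
    · rw [mul_div_assoc, sub_div, div_self hσ]
    · field_simp
  have h := (hsqrt.mul (tendsto_one_of_tendsto_mul_sub_one hR)).add hR
  rw [show (-1 / 4 / 2 * 1 + -1 / 32 : ℝ) = -5 / 32 by norm_num] at h
  refine h.congr' ?_
  filter_upwards [eventually_ne_atTop 0] with n hn
  rw [rookWalkCount_diag_div_eq hn]
  ring
end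

section
/- For every fixed n ≥ 1, the number w_n(d) of d-dimensional rook walks from the origin to (n,n,…,n) satisfies w_n(d) ~ e^{n−1} · (nd)! / (n!)^d as d → ∞; that is, the quotient w_n(d) · (n!)^d / (e^{n−1} · (nd)!) tends to 1 as d → ∞. -/
open Filter Real

open Finset in
lemma Polynomial.coeff_prod_eq_sum_piAntidiag {ι R : Type*} [Fintype ι] [DecidableEq ι]
    [CommSemiring R] (f : ι → Polynomial R) (r : ℕ) :
    (∏ i, f i).coeff r = ∑ k ∈ piAntidiag univ r, ∏ i, (f i).coeff (k i) := by
  rw [← Polynomial.coeff_coe, ← Polynomial.coeToPowerSeries.ringHom_apply, map_prod,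
    PowerSeries.coeff_prod]
  refine Finset.sum_bij' (fun k _ => ⇑k) (fun k _ => Finsupp.equivFunOnFinite.symm k) ?_ ?_ ?_ ?_ ?_
  all_goals simp

lemma sum_antidiagonal_pow_div_factorial (x y : ℝ) (m : ℕ) :
    ∑ p ∈ Finset.HasAntidiagonal.antidiagonal m, x ^ p.1 / p.1.factorial * (y ^ p.2 / p.2.factorial) =
      (x + y) ^ m / m.factorial := by
  rw [(Commute.all x y).add_pow', Finset.sum_div]
  refine Finset.sum_congr rfl fun p hp => ?_
  obtain rfl := Finset.HasAntidiagonal.mem_antidiagonal.mp hp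
  have h : ((p.1 + p.2).choose p.1 : ℝ) * p.1.factorial * p.2.factorial =
    (p.1 + p.2).factorial := by
    rw [Nat.choose_symm_add]
    exact_mod_cast Nat.add_choose_mul_factorial_mul_factorial p.1 p.2
  rw [nsmul_eq_mul, ← h]
  have h0 : ((p.1 + p.2).choose p.1 : ℝ) ≠ 0 := by
    exact_mod_cast (Nat.choose_pos (Nat.le_add_right _ _)).ne'
  field_simp

/-- Coefficientwise domination by `exp (C x)` is multiplicative. -/
lemma Polynomial.coeff_pow_le_of_coeff_le {P : Polynomial ℝ} {C : ℝ}
    (hC : 0 ≤ C) (h0 : ∀ j, 0 ≤ P.coeff j) (h : ∀ j, P.coeff j ≤ C ^ j / j.factorial) (d : ℕ) :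
    ∀ m, 0 ≤ (P ^ d).coeff m ∧ (P ^ d).coeff m ≤ (d * C) ^ m / m.factorial := by
  induction d with
  | zero =>
    intro m
    rcases m with _ | m <;> simp [Polynomial.coeff_one]
  | succ d ih =>
    intro m
    rw [pow_succ, Polynomial.coeff_mul]
    refine ⟨Finset.sum_nonneg fun p _ => mul_nonneg (ih _).1 (h0 _), ?_⟩
    have : ((d + 1 : ℕ) : ℝ) * C = d * C + C := by push_cast; ring
    rw [this, ← sum_antidiagonal_pow_div_factorial]
    exact Finset.sum_le_sum fun p _ => mul_le_mul (ih _).2 (h _) (h0 _) (by positivity)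

lemma Polynomial.exists_coeff_le_pow_div_factorial (P : Polynomial ℝ) (h1 : P.coeff 0 = 1) :
    ∃ C : ℝ, 0 ≤ C ∧ ∀ j, P.coeff j ≤ C ^ j / j.factorial := by
  obtain ⟨M, hM⟩ := ((Finset.range (P.natDegree + 1)).image
    fun j => P.coeff j * j.factorial).bddAbove
  have hC : 1 ≤ max M 1 := le_max_right _ _
  refine ⟨max M 1, by positivity, fun j => ?_⟩
  rw [le_div_iff₀ (by positivity)]
  rcases Nat.eq_zero_or_pos j with rfl | hj
  · simp [h1]
  by_cases hjn : j ≤ P.natDegree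
  · have : P.coeff j * j.factorial ≤ M := hM (by
      simp only [Finset.coe_image, Set.mem_image, Finset.mem_coe, Finset.mem_range]
      exact ⟨j, by omega, rfl⟩)
    exact this.trans ((le_max_left _ _).trans (le_self_pow₀ hC hj.ne'))
  · rw [Polynomial.coeff_eq_zero_of_natDegree_lt (by omega)]
    simp only [zero_mul]
    positivity

open Topology in
lemma tendsto_choose_div_pow (k : ℕ) :
    Tendsto (fun d : ℕ => (d.choose k : ℝ) / (d : ℝ) ^ k) atTop (𝓝 (1 / k.factorial)) := by
  have h1 : Tendsto (fun d : ℕ => (d : ℝ) ^ k / k.factorial / (d : ℝ) ^ k) atTop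
      (𝓝 (1 / k.factorial)) := by
    refine tendsto_const_nhds.congr' ?_
    filter_upwards [eventually_gt_atTop 0] with d hd
    have : (d : ℝ) ≠ 0 := by positivity
    field_simp
  exact (((isEquivalent_choose k).div Asymptotics.IsEquivalent.refl).tendsto_nhds_iff).mpr h1

open Topology in
/-- The leading behaviour of a fixed coefficient of a high power of a polynomial with constant
term `1`. -/
lemma Polynomial.tendsto_coeff_pow_div_pow {P : Polynomial ℝ} (h1 : P.coeff 0 = 1) (m : ℕ) :
    Tendsto (fun d : ℕ => (P ^ d).coeff m / (d : ℝ) ^ m) atTop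
      (𝓝 (P.coeff 1 ^ m / m.factorial)) := by
  obtain ⟨R, hR⟩ : Polynomial.X ∣ P - 1 := by
    rw [Polynomial.X_dvd_iff]; simp [h1]
  have hP : P = Polynomial.X * R + 1 := by rw [← hR]; ring
  have hP1 : P.coeff 1 = R.coeff 0 := by
    rw [hP, Polynomial.coeff_add, show (1 : ℕ) = 0 + 1 from rfl, Polynomial.coeff_X_mul]
    simp [Polynomial.coeff_one]
  have expand (d : ℕ) (hd : m ≤ d) : (P ^ d).coeff m =
      ∑ k ∈ Finset.range (m + 1), (R ^ k).coeff (m - k) * d.choose k := by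
    rw [hP, add_pow, Polynomial.finsetSum_coeff]
    symm
    refine Finset.sum_subset_zero_on_sdiff (Finset.range_mono (by omega)) ?_ ?_
    · intro k hk
      simp only [Finset.mem_sdiff, Finset.mem_range] at hk
      rw [one_pow, mul_one, ← Polynomial.C_eq_natCast, Polynomial.coeff_mul_C, mul_pow,
        Polynomial.coeff_X_pow_mul', if_neg (by omega), zero_mul]
    · intro k hk
      simp only [Finset.mem_range] at hk
      rw [one_pow, mul_one, ← Polynomial.C_eq_natCast, Polynomial.coeff_mul_C, mul_pow,
        Polynomial.coeff_X_pow_mul', if_pos (by omega)]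
  have lim : Tendsto (fun d : ℕ => ∑ k ∈ Finset.range (m + 1),
      (R ^ k).coeff (m - k) * ((d.choose k : ℝ) / (d : ℝ) ^ k * ((d : ℝ)⁻¹) ^ (m - k))) atTop
      (𝓝 (∑ k ∈ Finset.range (m + 1),
        (R ^ k).coeff (m - k) * (1 / k.factorial * 0 ^ (m - k)))) :=
    tendsto_finsetSum _ fun k _ => ((tendsto_choose_div_pow k).mul
      (tendsto_inv_atTop_nhds_zero_nat.pow _)).const_mul _
  have value : ∑ k ∈ Finset.range (m + 1),
      (R ^ k).coeff (m - k) * (1 / (k.factorial : ℝ) * 0 ^ (m - k)) =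
      P.coeff 1 ^ m / m.factorial := by
    rw [Finset.sum_range_succ, Finset.sum_eq_zero]
    · rw [hP1, Nat.sub_self, Polynomial.coeff_zero_eq_eval_zero, Polynomial.eval_pow,
        Polynomial.coeff_zero_eq_eval_zero]
      ring
    · intro k hk
      rw [Finset.mem_range] at hk
      rw [zero_pow (by omega)]
      ring
  rw [value] at lim
  refine lim.congr' ?_
  filter_upwards [eventually_ge_atTop m, eventually_gt_atTop 0] with d hd hd0
  rw [expand d hd, Finset.sum_div]
  refine Finset.sum_congr rfl fun k hk => ?_
  rw [Finset.mem_range] at hk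
  have : (d : ℝ) ≠ 0 := by positivity
  rw [show (d : ℝ) ^ m = (d : ℝ) ^ k * (d : ℝ) ^ (m - k) by rw [← pow_add]; congr 1; omega, inv_pow]
  field_simp

open Topology in
lemma tendsto_factorial_mul_pow_div_factorial {n : ℕ} (hn : 1 ≤ n) (m : ℕ) :
    Tendsto (fun d : ℕ => ((n * d - m).factorial : ℝ) * (d : ℝ) ^ m / (n * d).factorial) atTop
      (𝓝 (1 / (n : ℝ) ^ m)) := by
  have hnd : Tendsto (fun d : ℕ => n * d) atTop atTop := tendsto_id.const_mul_atTop' hn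
  have h := ((Asymptotics.IsEquivalent.refl
    (u := fun d : ℕ => (d : ℝ) ^ m)).div ((isEquivalent_descFactorial m).comp_tendsto hnd))
  have h1 : Tendsto (fun d : ℕ => (d : ℝ) ^ m / ((n * d : ℕ) : ℝ) ^ m) atTop
      (𝓝 (1 / (n : ℝ) ^ m)) := by
    refine tendsto_const_nhds.congr' ?_
    filter_upwards [eventually_gt_atTop 0] with d hd
    have : (d : ℝ) ≠ 0 := by positivity
    have : (n : ℝ) ≠ 0 := by positivity
    rw [Nat.cast_mul, mul_pow]
    field_simp
  refine (h.tendsto_nhds_iff.mpr h1).congr' ?_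
  filter_upwards [eventually_ge_atTop m] with d hd
  have hle : m ≤ n * d := hd.trans (Nat.le_mul_of_pos_left d hn)
  have e : ((n * d).factorial : ℝ) = (n * d - m).factorial * (n * d).descFactorial m := by
    exact_mod_cast (Nat.factorial_mul_descFactorial hle).symm
  have hd0 : ((n * d).descFactorial m : ℝ) ≠ 0 := by
    exact_mod_cast (Nat.descFactorial_pos.mpr hle).ne'
  simp only [Pi.div_apply, Function.comp_apply]
  rw [e]
  field_simp

lemma factorial_sub_mul_pow_le {n d m : ℕ} (h : m + d ≤ n * d) :
    (n * d - m).factorial * d ^ m ≤ (n * d).factorial := by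
  calc (n * d - m).factorial * d ^ m ≤ (n * d - m).factorial * (n * d - m + 1) ^ m := by
        gcongr; omega
    _ ≤ (n * d - m + m).factorial := Nat.factorial_mul_pow_le_factorial
    _ = _ := by rw [Nat.sub_add_cancel (by omega)]

open Topology in
/-- If `G` is a monic polynomial of degree `n` with nonnegative coefficients and no constant term,
the functional `X ^ r ↦ r!` applied to `G ^ d` is asymptotic to its leading term times
`exp (G.coeff (n - 1) / n)`. -/
lemma Polynomial.tendsto_sum_factorial_mul_coeff_pow {n : ℕ} (hn : 1 ≤ n) {G : Polynomial ℝ}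
    (hG : G.natDegree = n) (hmonic : G.Monic) (hG0 : G.coeff 0 = 0) (hnn : ∀ j, 0 ≤ G.coeff j) :
    Tendsto (fun d : ℕ => (∑ r ∈ Finset.range (n * d + 1), (r.factorial : ℝ) * (G ^ d).coeff r) /
      (n * d).factorial) atTop (𝓝 (Real.exp (G.coeff (n - 1) / n))) := by
  set P := G.reverse with hP
  have hPd (d : ℕ) : (G ^ d).reverse = P ^ d := by
    induction d with
    | zero => simpa using Polynomial.reverse_C (1 : ℝ)
    | succ d ih => rw [pow_succ, Polynomial.reverse_mul_of_domain, ih, pow_succ]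
  have hcoeff (d m : ℕ) (hm : m ≤ n * d) : (P ^ d).coeff m = (G ^ d).coeff (n * d - m) := by
    rw [← hPd, Polynomial.coeff_reverse, Polynomial.natDegree_pow, hG, mul_comm d n,
      Polynomial.revAt_le hm]
  have hP0 : P.coeff 0 = 1 := by rw [hP, Polynomial.coeff_zero_reverse]; exact hmonic
  have hP1 : P.coeff 1 = G.coeff (n - 1) := by
    rw [hP, Polynomial.coeff_reverse, hG, Polynomial.revAt_le hn]
  have hPnn (j : ℕ) : 0 ≤ P.coeff j := by rw [hP, Polynomial.coeff_reverse]; exact hnn _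
  have hvanish (d m : ℕ) (h : n * d < m + d) : (P ^ d).coeff m = 0 := by
    by_cases hm : m ≤ n * d
    · rw [hcoeff d m hm]
      exact Polynomial.X_pow_dvd_iff.mp (pow_dvd_pow_of_dvd (Polynomial.X_dvd_iff.mpr hG0) d) _
        (by omega)
    · rw [← hPd, Polynomial.coeff_eq_zero_of_natDegree_lt]
      refine (Polynomial.reverse_natDegree_le _).trans_lt ?_
      rw [Polynomial.natDegree_pow, hG, mul_comm]
      omega
  obtain ⟨C, hC, hPC⟩ := Polynomial.exists_coeff_le_pow_div_factorial P hP0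
  have key := tendsto_tsum_of_dominated_convergence (𝓕 := atTop)
    (f := fun d m : ℕ => ((n * d - m).factorial : ℝ) * (P ^ d).coeff m / (n * d).factorial)
    (g := fun m : ℕ => (P.coeff 1 / n) ^ m / m.factorial)
    (bound := fun m : ℕ => C ^ m / m.factorial) (Real.summable_pow_div_factorial C) ?_ ?_
  · have hexp : ∑' m : ℕ, (P.coeff 1 / n) ^ m / (m.factorial : ℝ) =
        Real.exp (G.coeff (n - 1) / n) := by
      rw [Real.exp_eq_exp_ℝ, NormedSpace.exp_eq_tsum_div, hP1]
    rw [hexp] at key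
    refine key.congr fun d => ?_
    rw [tsum_eq_sum (s := Finset.range (n * d + 1)), ← Finset.sum_div,
      ← Finset.sum_range_reflect]
    · congr 1
      refine Finset.sum_congr rfl fun m hm => ?_
      rw [Finset.mem_range] at hm
      rw [hcoeff _ _ (by omega)]
      congr <;> omega
    · intro m hm
      rw [Finset.mem_range] at hm
      rw [hvanish d m (by omega)]
      simp
  · intro m
    have hlim : (P.coeff 1 / n) ^ m / (m.factorial : ℝ) =
        1 / (n : ℝ) ^ m * (P.coeff 1 ^ m / m.factorial) := by
      rw [div_pow]; ring
    rw [hlim]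
    refine ((tendsto_factorial_mul_pow_div_factorial hn m).mul
      (Polynomial.tendsto_coeff_pow_div_pow hP0 m)).congr' ?_
    filter_upwards [eventually_gt_atTop 0] with d hd
    have : (d : ℝ) ≠ 0 := by positivity
    field_simp
  · filter_upwards [eventually_gt_atTop 0] with d hd m
    obtain ⟨hnn', hle⟩ := Polynomial.coeff_pow_le_of_coeff_le hC hPnn hPC d m
    rw [Real.norm_of_nonneg (by positivity)]
    by_cases h : n * d < m + d
    · rw [hvanish d m h]
      simp only [mul_zero, zero_div]
      positivity
    · rw [div_le_iff₀ (by positivity)]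
      have hf : ((n * d - m).factorial : ℝ) * (d : ℝ) ^ m ≤ (n * d).factorial := by
        exact_mod_cast factorial_sub_mul_pow_le (not_lt.mp h)
      calc ((n * d - m).factorial : ℝ) * (P ^ d).coeff m
          ≤ (n * d - m).factorial * ((d * C) ^ m / m.factorial) := by gcongr
        _ = C ^ m / m.factorial * ((n * d - m).factorial * (d : ℝ) ^ m) := by
          rw [mul_pow]; ring
        _ ≤ _ := by gcongr

open Finset in
lemma MvPolynomial.coeff_prod_aeval_X {σ R : Type*} [Fintype σ] [CommSemiring R]
    (g : σ → Polynomial R) (v : σ →₀ ℕ) :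
    MvPolynomial.coeff v (∏ i, Polynomial.aeval (MvPolynomial.X i : MvPolynomial σ R) (g i)) =
      ∏ i, (g i).coeff (v i) := by
  classical
  have expand (i : σ) : Polynomial.aeval (MvPolynomial.X i : MvPolynomial σ R) (g i) =
      ∑ j ∈ range ((g i).natDegree + 1),
        MvPolynomial.monomial (Finsupp.single i j) ((g i).coeff j) := by
    rw [Polynomial.aeval_eq_sum_range' (Nat.lt_succ_self _)]
    refine Finset.sum_congr rfl fun j _ => ?_
    rw [MvPolynomial.X_pow_eq_monomial, MvPolynomial.smul_monomial, smul_eq_mul, mul_one]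
  have term (x : σ → ℕ) : MvPolynomial.coeff v
      (∏ i, MvPolynomial.monomial (Finsupp.single i (x i)) ((g i).coeff (x i))) =
      if x = v then ∏ i, (g i).coeff (v i) else 0 := by
    rw [← MvPolynomial.monomial_sum_prod, MvPolynomial.coeff_monomial]
    have hx : ∑ i, Finsupp.single i (x i) = v ↔ x = v := by
      rw [DFunLike.ext_iff, _root_.funext_iff]
      simp [Finsupp.finsetSum_apply, Finsupp.single_apply]
    by_cases h : x = v
    · rw [if_pos (hx.mpr h), if_pos h, h]
    · rw [if_neg (mt hx.mp h), if_neg h]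
  simp_rw [expand, prod_univ_sum, MvPolynomial.coeff_sum, term]
  rw [Finset.sum_ite_eq', ite_eq_left_iff]
  intro hv
  simp only [Fintype.mem_piFinset, mem_range, not_forall, not_lt] at hv
  obtain ⟨i, hi⟩ := hv
  exact (Finset.prod_eq_zero (mem_univ i)
    (Polynomial.coeff_eq_zero_of_natDegree_lt (by omega))).symm

/-- The generating polynomial `X + X ^ 2 + ⋯ + X ^ n` of the admissible amounts of a step. -/
noncomputable def amountPoly (n : ℕ) : Polynomial ℕ :=
  ∑ j ∈ Finset.Icc 1 n, Polynomial.X ^ j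

/-- Sequences of `r` steps in `d` dimensions, of amounts between `1` and `n`, leading to
`(n, …, n)`. -/
def stepSequences (n d r : ℕ) : Finset (Fin r → Fin d × ℕ) :=
  (Fintype.piFinset fun _ => Finset.univ ×ˢ Finset.Icc 1 n).filter
    fun p => ∀ i, ∑ j, (if (p j).1 = i then (p j).2 else 0) = n

open Finset in
lemma card_stepSequences (n d r : ℕ) :
    #(stepSequences n d r) =
      ∑ k ∈ piAntidiag (univ : Finset (Fin d)) r,
        Nat.multinomial univ k * ∏ i, (amountPoly n ^ k i).coeff n := by
  have via_steps : MvPolynomial.coeff (Finsupp.equivFunOnFinite.symm fun _ : Fin d => n)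
      ((∑ s ∈ (univ : Finset (Fin d)) ×ˢ Icc 1 n,
        (MvPolynomial.X s.1 : MvPolynomial (Fin d) ℕ) ^ s.2) ^ r) = #(stepSequences n d r) := by
    rw [sum_pow', MvPolynomial.coeff_sum, stepSequences, card_filter]
    refine Finset.sum_congr rfl fun p _ => ?_
    simp_rw [MvPolynomial.X_pow_eq_monomial]
    rw [← MvPolynomial.monomial_sum_one, MvPolynomial.coeff_monomial]
    refine if_congr ?_ rfl rfl
    rw [DFunLike.ext_iff]
    simp [Finsupp.finsetSum_apply, Finsupp.single_apply]
  rw [← via_steps, Finset.sum_product]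
  have inner (i : Fin d) : ∑ j ∈ Icc 1 n, (MvPolynomial.X i : MvPolynomial (Fin d) ℕ) ^ j =
      Polynomial.aeval (MvPolynomial.X i : MvPolynomial (Fin d) ℕ) (amountPoly n) := by
    simp [amountPoly]
  simp_rw [inner, sum_pow_eq_sum_piAntidiag, MvPolynomial.coeff_sum, ← map_pow]
  refine Finset.sum_congr rfl fun k _ => ?_
  rw [← nsmul_eq_mul, MvPolynomial.coeff_smul, MvPolynomial.coeff_prod_aeval_X]
  simp

lemma length_le_of_mem_rookWalks {n d : ℕ} {L : List (Fin d × ℕ)}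
    (hL : L ∈ RookWalks d fun _ => n) : L.length ≤ n * d := by
  have hsum : (L.map Prod.snd).sum = n * d := by
    have h : ∑ i : Fin d, (L.map fun s => if s.1 = i then s.2 else 0).sum = n * d := by
      rw [Finset.sum_congr rfl fun i _ => hL.2 i]
      simp [mul_comm]
    rw [← h]
    clear h hL
    induction L with
    | nil => simp
    | cons s L ih => simp [Finset.sum_add_distrib, ih]
  rw [← hsum]
  simpa using List.length_le_sum_of_one_le (L.map Prod.snd) (by
    intro a ha
    obtain ⟨s, hs, rfl⟩ := List.mem_map.mp ha
    exact hL.1 s hs)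

lemma ofFn_mem_rookWalks_iff {n d r : ℕ} (p : Fin r → Fin d × ℕ) :
    List.ofFn p ∈ (RookWalks d fun _ => n) ↔ p ∈ stepSequences n d r := by
  simp only [RookWalks, stepSequences, Set.mem_ofPred_eq, List.map_ofFn, List.sum_ofFn,
    Finset.mem_filter, Fintype.mem_piFinset, Finset.mem_product, Finset.mem_univ, true_and,
    Finset.mem_Icc, List.forall_mem_ofFn_iff, Function.comp_apply]
  refine ⟨fun ⟨hpos, hsum⟩ => ⟨fun j => ⟨hpos j, ?_⟩, hsum⟩,
    fun ⟨h, hsum⟩ => ⟨fun j => (h j).1, hsum⟩⟩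
  rw [← hsum (p j).1]
  simpa using Finset.single_le_sum
    (f := fun l => if (p l).1 = (p j).1 then (p l).2 else 0) (fun _ _ => Nat.zero_le _)
    (Finset.mem_univ j)

open Finset in
lemma rookWalkCount_eq_sum_s14 (n d : ℕ) :
    rookWalkCount d (fun _ => n) = ∑ r ∈ range (n * d + 1), #(stepSequences n d r) := by
  have h : RookWalks d (fun _ => n) =
      ↑(((range (n * d + 1)).sigma fun r => stepSequences n d r).image
        fun p => List.ofFn p.2) := by
    ext L
    simp only [coe_image, Set.mem_image, mem_coe, mem_sigma, mem_range]
    constructor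
    · intro hL
      refine ⟨⟨L.length, L.get⟩, ⟨?_, ?_⟩, List.ofFn_get L⟩
      · exact Nat.lt_succ_of_le (length_le_of_mem_rookWalks hL)
      · rwa [← ofFn_mem_rookWalks_iff, List.ofFn_get]
    · rintro ⟨⟨r, p⟩, ⟨_, hp⟩, rfl⟩
      exact (ofFn_mem_rookWalks_iff p).mpr hp
  rw [rookWalkCount, h, Set.ncard_coe_finset, card_image_of_injective, card_sigma]
  exact fun p q hpq => List.ofFn_inj'.mp hpq

/-- The polynomial `∑ k, n! c(k) / k! X ^ k`, where `c(k)` is the number of compositions of `n`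
into `k` parts. -/
noncomputable def compositionPoly (n : ℕ) : Polynomial ℝ :=
  ∑ k ∈ Finset.range (n + 1), Polynomial.monomial k
    (n.factorial * (amountPoly n ^ k).coeff n / k.factorial : ℝ)

lemma amountPoly_eq_X_mul (n : ℕ) :
    amountPoly n = Polynomial.X * ∑ j ∈ Finset.range n, Polynomial.X ^ j := by
  rw [amountPoly, Finset.mul_sum, ← Finset.Ico_add_one_right_eq_Icc,
    Finset.sum_Ico_eq_sum_range]
  simp [pow_add]

lemma coeff_amountPoly_pow (n k m : ℕ) : (amountPoly n ^ k).coeff m =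
    if k ≤ m then ((∑ j ∈ Finset.range n, (Polynomial.X : Polynomial ℕ) ^ j) ^ k).coeff (m - k)
    else 0 := by
  rw [amountPoly_eq_X_mul, mul_pow, Polynomial.coeff_X_pow_mul']

lemma coeff_compositionPoly (n k : ℕ) : (compositionPoly n).coeff k =
    n.factorial * (amountPoly n ^ k).coeff n / k.factorial := by
  simp only [compositionPoly, Polynomial.finsetSum_coeff, Polynomial.coeff_monomial]
  rw [Finset.sum_ite_eq', ite_eq_left_iff]
  intro hk
  rw [Finset.mem_range] at hk
  rw [coeff_amountPoly_pow, if_neg (by omega)]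
  simp

lemma coeff_compositionPoly_self {n : ℕ} (hn : 1 ≤ n) : (compositionPoly n).coeff n = 1 := by
  rw [coeff_compositionPoly, coeff_amountPoly_pow, if_pos le_rfl, Nat.sub_self,
    Polynomial.coeff_zero_eq_eval_zero, Polynomial.eval_pow, Polynomial.eval_finsetSum]
  have h : ∑ j ∈ Finset.range n, Polynomial.eval 0 ((Polynomial.X : Polynomial ℕ) ^ j) = 1 := by
    rw [Finset.sum_eq_single_of_mem 0 (Finset.mem_range.mpr hn)]
    · simp
    · intro j _ hj
      simp [hj]
  rw [h]
  have : (n.factorial : ℝ) ≠ 0 := by positivity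
  simp [this]

lemma coeff_compositionPoly_pred {n : ℕ} (hn : 1 ≤ n) :
    (compositionPoly n).coeff (n - 1) = n * ((n : ℝ) - 1) := by
  obtain ⟨k, rfl⟩ : ∃ k, n = k + 1 := ⟨n - 1, by omega⟩
  have hcoeff : ((∑ j ∈ Finset.range (k + 1), (Polynomial.X : Polynomial ℕ) ^ j) ^ k).coeff 1
      = k := by
    rcases k with _ | k
    · simp [Polynomial.coeff_one]
    · rw [← Polynomial.coeff_coe, Polynomial.coe_pow, PowerSeries.coeff_one_pow,
        ← PowerSeries.coeff_zero_eq_constantCoeff_apply, Polynomial.coeff_coe,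
        Polynomial.coeff_coe]
      simp [Polynomial.finsetSum_coeff, Polynomial.coeff_X_pow]
  rw [coeff_compositionPoly, coeff_amountPoly_pow, if_pos (by omega), Nat.add_sub_cancel,
    Nat.add_sub_cancel_left, hcoeff, Nat.factorial_succ]
  push_cast
  field_simp
  ring

lemma natDegree_compositionPoly {n : ℕ} (hn : 1 ≤ n) : (compositionPoly n).natDegree = n := by
  refine le_antisymm ?_ (Polynomial.le_natDegree_of_ne_zero ?_)
  · exact Polynomial.natDegree_sum_le_of_forall_le _ _ fun k hk =>
      (Polynomial.natDegree_monomial_le _).trans (by rw [Finset.mem_range] at hk; omega)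
  · rw [coeff_compositionPoly_self hn]
    exact one_ne_zero

open Finset in
lemma card_stepSequences_mul_pow (n d r : ℕ) :
    (#(stepSequences n d r) : ℝ) * (n.factorial : ℝ) ^ d =
      r.factorial * (compositionPoly n ^ d).coeff r := by
  have h := Polynomial.coeff_prod_eq_sum_piAntidiag (fun _ : Fin d => compositionPoly n) r
  rw [prod_const, card_univ, Fintype.card_fin] at h
  rw [h, card_stepSequences, Nat.cast_sum, sum_mul, mul_sum]
  refine sum_congr rfl fun k hk => ?_
  obtain ⟨hk, -⟩ := mem_piAntidiag.mp hk
  have hm : (∏ i, ((k i).factorial : ℝ)) * Nat.multinomial univ k = r.factorial := by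
    rw [← hk]
    exact_mod_cast Nat.multinomial_spec univ k
  have hne : ∏ i, ((k i).factorial : ℝ) ≠ 0 := prod_ne_zero_iff.mpr fun i _ => by positivity
  simp_rw [coeff_compositionPoly, prod_div_distrib, prod_mul_distrib, ← hm]
  simp only [prod_const, card_univ, Fintype.card_fin]
  push_cast
  field_simp

/-- For every fixed `n ≥ 1`, the number `wₙ(d)` of `d`-dimensional rook walks
from the origin to `(n,…,n)` satisfies `wₙ(d) ~ e^{n−1}·(nd)!/(n!)^d` as
`d → ∞`. -/
theorem rook_fixed_n_asymptotics (n : ℕ) (hn : 1 ≤ n) :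
    Filter.Tendsto
      (fun d : ℕ =>
        (rookWalkCount d (fun _ => n) : ℝ) * (Nat.factorial n : ℝ) ^ d /
          (Real.exp ((n : ℝ) - 1) * (Nat.factorial (n * d) : ℝ)))
      Filter.atTop (nhds 1) := by
  have hmonic : (compositionPoly n).Monic := by
    rw [Polynomial.Monic, Polynomial.leadingCoeff, natDegree_compositionPoly hn,
      coeff_compositionPoly_self hn]
  have hzero : (compositionPoly n).coeff 0 = 0 := by
    rw [coeff_compositionPoly, pow_zero, Polynomial.coeff_one, if_neg (by omega)]
    simp
  have key := Polynomial.tendsto_sum_factorial_mul_coeff_pow hn (natDegree_compositionPoly hn)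
    hmonic hzero fun j => by rw [coeff_compositionPoly]; positivity
  have hn0 : (n : ℝ) ≠ 0 := by positivity
  rw [coeff_compositionPoly_pred hn, mul_div_cancel_left₀ _ hn0] at key
  have hexp := Real.exp_ne_zero ((n : ℝ) - 1)
  have lim := key.div_const (Real.exp ((n : ℝ) - 1))
  rw [div_self hexp] at lim
  refine lim.congr fun d => ?_
  rw [rookWalkCount_eq_sum_s14, Nat.cast_sum, Finset.sum_mul,
    Finset.sum_congr rfl fun r _ => card_stepSequences_mul_pow n d r]
  rw [div_div, mul_comm (Real.exp _)]
end
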